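/- Let q ∈ ℂ be nonzero and not a root of unity, and let n be a natural number. Then $\sum_{m=1}^{n}\frac{(-1)^m}{1-q^{2m}}\sum_{k=0}^{m}\binom{n}{k}_{q^2}\,q^{-2k(n-k-1)}\,(-1)^k\,q^{-(m-k)(m-k-1)}\binom{n-k}{m-k}_{q^{-2}} = -n$. (This is the value of the Chern–Connes pairing $(\tau^1\circ Tr)(e_{-n})$, showing the left Chern number of the quantum Hopf line bundle of winding number $-n$ equals $-n$.) -/

import Mathlib

/-- The `x`-binomial coefficient
`(x-1)(x²-1)⋯(xⁿ-1) / [(x-1)⋯(x^k-1) · (x-1)⋯(x^(n-k)-1)]`. -/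
noncomputable def qbin (x : ℂ) (n k : ℕ) : ℂ :=
  (∏ i ∈ Finset.range n, (x ^ (i + 1) - 1)) /
    ((∏ i ∈ Finset.range k, (x ^ (i + 1) - 1)) *
      (∏ i ∈ Finset.range (n - k), (x ^ (i + 1) - 1)))

open Finset

/-- The product `(x-1)(x²-1)⋯(xⁿ-1)`. -/
noncomputable def qfact (x : ℂ) (n : ℕ) : ℂ := ∏ i ∈ range n, (x ^ (i + 1) - 1)

/-- The Gaussian binomial coefficients, defined by the `q`-Pascal recursion. -/
noncomputable def gaussBinom (x : ℂ) : ℕ → ℕ → ℂ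
  | _, 0 => 1
  | 0, _ + 1 => 0
  | n + 1, k + 1 => x ^ (k + 1) * gaussBinom x n (k + 1) + gaussBinom x n k

lemma qfact_zero (x : ℂ) : qfact x 0 = 1 := by simp [qfact]

lemma qfact_succ (x : ℂ) (n : ℕ) : qfact x (n + 1) = qfact x n * (x ^ (n + 1) - 1) :=
  prod_range_succ _ _

lemma qfact_ne_zero {x : ℂ} (hx : ∀ k : ℕ, 0 < k → x ^ k ≠ 1) (n : ℕ) : qfact x n ≠ 0 :=
  prod_ne_zero_iff.2 fun i _ => sub_ne_zero.2 (hx _ i.succ_pos)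

lemma gaussBinom_zero_right (x : ℂ) (n : ℕ) : gaussBinom x n 0 = 1 := by
  cases n <;> rfl

lemma gaussBinom_succ_succ (x : ℂ) (n k : ℕ) :
    gaussBinom x (n + 1) (k + 1) = x ^ (k + 1) * gaussBinom x n (k + 1) + gaussBinom x n k :=
  rfl

lemma gaussBinom_eq_zero (x : ℂ) {n k : ℕ} (h : n < k) : gaussBinom x n k = 0 := by
  induction n generalizing k with
  | zero => obtain ⟨k, rfl⟩ := Nat.exists_eq_succ_of_ne_zero h.ne'; rfl
  | succ n ih =>
    obtain ⟨k, rfl⟩ := Nat.exists_eq_succ_of_ne_zero (Nat.ne_zero_of_lt h)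
    rw [Nat.succ_eq_add_one, gaussBinom_succ_succ, ih (by omega), ih (by omega)]
    simp

lemma gaussBinom_self (x : ℂ) (n : ℕ) : gaussBinom x n n = 1 := by
  induction n with
  | zero => rfl
  | succ n ih => simp [gaussBinom_succ_succ, ih, gaussBinom_eq_zero x n.lt_succ_self]

lemma gaussBinom_mul_qfact (x : ℂ) (k l : ℕ) :
    gaussBinom x (k + l) k * (qfact x k * qfact x l) = qfact x (k + l) := by
  induction k generalizing l with
  | zero => simp [gaussBinom_zero_right, qfact_zero]
  | succ k ihk =>
    induction l with
    | zero => simp [gaussBinom_self, qfact_zero]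
    | succ l ihl =>
      have h := ihk (l + 1)
      rw [show k + 1 + (l + 1) = (k + l + 1) + 1 by ring, gaussBinom_succ_succ,
        qfact_succ x (k + l + 1)]
      rw [show k + 1 + l = k + l + 1 by ring, qfact_succ x k] at ihl
      rw [← add_assoc, qfact_succ x l] at h
      rw [qfact_succ x k, qfact_succ x l]
      linear_combination (x ^ (k + 1) * (x ^ (l + 1) - 1)) * ihl + (x ^ (k + 1) - 1) * h

lemma qbin_add (x : ℂ) (k l : ℕ) :
    qbin x (k + l) k = qfact x (k + l) / (qfact x k * qfact x l) := by
  simp [qbin, qfact]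

lemma qbin_eq_gaussBinom {x : ℂ} (hx : ∀ k : ℕ, 0 < k → x ^ k ≠ 1) (k l : ℕ) :
    qbin x (k + l) k = gaussBinom x (k + l) k := by
  rw [qbin_add, div_eq_iff (mul_ne_zero (qfact_ne_zero hx _) (qfact_ne_zero hx _)),
    gaussBinom_mul_qfact]

/-- The finite `q`-binomial theorem. -/
lemma sum_gaussBinom (y z : ℂ) (m : ℕ) :
    ∑ j ∈ range (m + 1), (-1) ^ j * y ^ (j.choose 2) * gaussBinom y m j * z ^ j =
      ∏ i ∈ range m, (1 - z * y ^ i) := by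
  induction m generalizing z with
  | zero => simp [gaussBinom_zero_right]
  | succ m ih =>
    have hz : ∏ i ∈ range (m + 1), (1 - z * y ^ i) =
        (1 - z) * ∏ i ∈ range m, (1 - z * y * y ^ i) := by
      rw [prod_range_succ', mul_comm]
      congr 1
      · simp
      · exact prod_congr rfl fun i _ => by ring
    have hstep : ∀ j, (-1 : ℂ) ^ (j + 1) * y ^ ((j + 1).choose 2) * gaussBinom y (m + 1) (j + 1)
          * z ^ (j + 1) =
        (-1) ^ (j + 1) * y ^ ((j + 1).choose 2) * gaussBinom y m (j + 1) * (z * y) ^ (j + 1) -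
          z * ((-1) ^ j * y ^ (j.choose 2) * gaussBinom y m j * (z * y) ^ j) := by
      intro j
      rw [gaussBinom_succ_succ, Nat.choose_succ_succ' j 1, Nat.choose_one_right]
      ring
    have hlast := sum_range_succ
      (fun j => (-1) ^ j * y ^ (j.choose 2) * gaussBinom y m j * (z * y) ^ j) (m + 1)
    rw [sum_range_succ', ih, gaussBinom_eq_zero y m.lt_succ_self] at hlast
    rw [hz, sum_range_succ', sum_congr rfl fun j _ => hstep j, sum_sub_distrib, ← mul_sum, ih]
    simp only [gaussBinom_zero_right] at hlast ⊢
    linear_combination hlast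

lemma sum_range_neg_one_pow_mul_qfact (y : ℂ) (n : ℕ) :
    ∑ m ∈ range n, (-1) ^ m * qfact y m * gaussBinom y n (m + 1) = n := by
  induction n with
  | zero => simp
  | succ n ih =>
    have hstep : ∀ m, (-1) ^ m * qfact y m * gaussBinom y (n + 1) (m + 1) =
        (-1) ^ m * qfact y m * gaussBinom y n (m + 1) -
          ((-1) ^ (m + 1) * qfact y (m + 1) * gaussBinom y n (m + 1) -
            (-1) ^ m * qfact y m * gaussBinom y n m) := by
      intro m
      rw [gaussBinom_succ_succ, qfact_succ]
      ring
    rw [sum_congr rfl fun m _ => hstep m, sum_sub_distrib,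
      sum_range_sub (fun m => (-1) ^ m * qfact y m * gaussBinom y n m), sum_range_succ, ih,
      gaussBinom_eq_zero y n.lt_succ_self, gaussBinom_zero_right, qfact_zero]
    simp

lemma qfact_inv {x : ℂ} (hx : x ≠ 0) (n : ℕ) :
    qfact x n = (-1) ^ n * x ^ ((n + 1).choose 2) * qfact x⁻¹ n := by
  induction n with
  | zero => simp [qfact_zero]
  | succ n ih =>
    rw [qfact_succ, qfact_succ, ih, Nat.choose_succ_succ' (n + 1) 1, Nat.choose_one_right, inv_pow]
    field_simp
    ring

lemma choose_two_add_succ (k l : ℕ) :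
    (k + l + 1).choose 2 = (k + 1).choose 2 + (l + 1).choose 2 + k * l := by
  induction l with
  | zero => simp
  | succ l ih =>
    rw [Nat.choose_succ_succ' (l + 1) 1, ← add_assoc, Nat.choose_succ_succ' (k + l + 1) 1, ih]
    simp only [Nat.choose_one_right]
    ring

lemma qbin_inv {x : ℂ} (hx : x ≠ 0) (k l : ℕ) :
    qbin x (k + l) k = x ^ (k * l) * qbin x⁻¹ (k + l) k := by
  rw [qbin_add, qbin_add, qfact_inv hx, qfact_inv hx k, qfact_inv hx l, choose_two_add_succ]
  have h : ((-1 : ℂ) ^ k * (-1) ^ l) * (x ^ (k + 1).choose 2 * x ^ (l + 1).choose 2) ≠ 0 := by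
    simp [hx]
  rw [mul_div_assoc', ← mul_div_mul_left (x ^ (k * l) * _) _ h]
  congr 1 <;> ring

lemma qbin_mul_qbin {x : ℂ} (hx : ∀ k : ℕ, 0 < k → x ^ k ≠ 1) (k j l : ℕ) :
    qbin x (k + (j + l)) k * qbin x (j + l) j =
      qbin x (k + j + l) (k + j) * qbin x (j + k) j := by
  simp only [qbin_add]
  rw [add_comm j k, ← add_assoc]
  have := qfact_ne_zero hx
  field_simp [this]

lemma two_mul_choose_two_cast (j : ℕ) : 2 * ((j.choose 2 : ℕ) : ℤ) = (j : ℤ) * (j - 1) := by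
  induction j with
  | zero => simp
  | succ j ih =>
    rw [Nat.choose_succ_succ' j 1, Nat.choose_one_right]
    push_cast
    linear_combination ih

lemma summand_eq {q : ℂ} (hq : q ≠ 0) (hroot : ∀ k : ℕ, 0 < k → (q ^ 2)⁻¹ ^ k ≠ 1) (k j l : ℕ) :
    qbin (q ^ 2) (k + (j + l)) k *
          q ^ ((-2 : ℤ) * k * (((k + (j + l) : ℕ) : ℤ) - k - 1)) * (-1 : ℂ) ^ k *
        q ^ (-((j : ℤ) * ((j : ℤ) - 1))) * qbin (q ^ 2)⁻¹ (j + l) j =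
      (-1) ^ (k + j) * (q ^ 2) ^ (k + j) * gaussBinom (q ^ 2)⁻¹ (k + j + l) (k + j) *
        ((-1) ^ j * (q ^ 2)⁻¹ ^ (j.choose 2) * gaussBinom (q ^ 2)⁻¹ (k + j) j *
          (q ^ 2)⁻¹ ^ j) := by
  have hs : (-1 : ℂ) ^ (k + j) * (-1) ^ j = (-1) ^ k := by
    rw [pow_add, mul_assoc, ← mul_pow]; simp
  have h1 : q ^ ((-2 : ℤ) * k * (((k + (j + l) : ℕ) : ℤ) - k - 1)) * (q ^ 2) ^ (k * (j + l)) =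
      (q ^ 2) ^ k := by
    simp only [← zpow_natCast, ← zpow_mul, ← zpow_add₀ hq]
    congr 1
    push_cast
    ring
  have h2 : q ^ (-((j : ℤ) * ((j : ℤ) - 1))) = (q ^ 2)⁻¹ ^ (j.choose 2) := by
    rw [← two_mul_choose_two_cast, zpow_neg, inv_pow, zpow_mul, zpow_natCast]
    rfl
  have h3 : (q ^ 2) ^ (k + j) * (q ^ 2)⁻¹ ^ j = (q ^ 2) ^ k := by
    rw [pow_add, mul_assoc, ← mul_pow, mul_inv_cancel₀ (pow_ne_zero 2 hq), one_pow, mul_one]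
  have h4 := qbin_mul_qbin hroot k j l
  rw [qbin_eq_gaussBinom hroot (k + j), qbin_eq_gaussBinom hroot j k, add_comm j k] at h4
  rw [qbin_inv (pow_ne_zero 2 hq), h2]
  set y := (q ^ 2)⁻¹
  calc _ = (q ^ ((-2 : ℤ) * k * (((k + (j + l) : ℕ) : ℤ) - k - 1)) * (q ^ 2) ^ (k * (j + l))) *
        (-1) ^ k * y ^ (j.choose 2) * (qbin y (k + (j + l)) k * qbin y (j + l) j) := by ring
    _ = ((q ^ 2) ^ (k + j) * y ^ j) * ((-1 : ℂ) ^ (k + j) * (-1) ^ j) * y ^ (j.choose 2) *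
        (gaussBinom y (k + j + l) (k + j) * gaussBinom y (k + j) j) := by rw [h1, h3, h4, hs]
    _ = _ := by ring

lemma prod_one_sub_mul_pow (y : ℂ) (m : ℕ) :
    ∏ i ∈ range m, (1 - y * y ^ i) = (-1) ^ m * qfact y m := by
  induction m with
  | zero => simp [qfact_zero]
  | succ m ih => rw [prod_range_succ, ih, qfact_succ]; ring

theorem stmt0 (q : ℂ) (hq : q ≠ 0) (hroot : ∀ k : ℕ, 0 < k → q ^ k ≠ 1) (n : ℕ) :
    ∑ m ∈ Finset.Icc 1 n,
      ((-1 : ℂ) ^ m / (1 - q ^ (2 * m))) *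
        ∑ k ∈ Finset.range (m + 1),
          qbin (q ^ 2) n k * q ^ ((-2 : ℤ) * k * ((n : ℤ) - k - 1)) * (-1 : ℂ) ^ k *
            q ^ (-(((m : ℤ) - k) * ((m : ℤ) - k - 1))) * qbin (q ^ (-2 : ℤ)) (n - k) (m - k)
      = -(n : ℂ) := by
  have hq2 : q ^ 2 ≠ 0 := pow_ne_zero 2 hq
  have hx : ∀ k : ℕ, 0 < k → (q ^ 2) ^ k ≠ 1 := fun k hk => by
    rw [← pow_mul]; exact hroot _ (by omega)
  have hy : ∀ k : ℕ, 0 < k → (q ^ 2)⁻¹ ^ k ≠ 1 := fun k hk => by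
    rw [inv_pow]; exact inv_ne_one.2 (hx k hk)
  have hq' : q ^ (-2 : ℤ) = (q ^ 2)⁻¹ := by rw [zpow_neg]; rfl
  have inner : ∀ m ≤ n, ∑ k ∈ Finset.range (m + 1),
      qbin (q ^ 2) n k * q ^ ((-2 : ℤ) * k * ((n : ℤ) - k - 1)) * (-1 : ℂ) ^ k *
        q ^ (-(((m : ℤ) - k) * ((m : ℤ) - k - 1))) * qbin (q ^ (-2 : ℤ)) (n - k) (m - k) =
      (q ^ 2) ^ m * gaussBinom (q ^ 2)⁻¹ n m * qfact (q ^ 2)⁻¹ m := by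
    intro m hm
    have hs : ((-1 : ℂ) ^ m) * (-1) ^ m = 1 := by rw [← mul_pow]; simp
    have hthm := sum_gaussBinom (q ^ 2)⁻¹ (q ^ 2)⁻¹ m
    rw [← sum_range_reflect, prod_one_sub_mul_pow] at hthm
    trans (-1) ^ m * (q ^ 2) ^ m * gaussBinom (q ^ 2)⁻¹ n m * ((-1) ^ m * qfact (q ^ 2)⁻¹ m)
    · rw [← hthm, mul_sum]
      refine sum_congr rfl fun k hk => ?_
      obtain ⟨j, rfl⟩ := Nat.exists_eq_add_of_le (Nat.lt_succ_iff.1 (mem_range.1 hk))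
      obtain ⟨l, rfl⟩ := Nat.exists_eq_add_of_le hm
      have h := summand_eq hq hy k j l
      rw [← add_assoc k j l] at h
      rw [hq', show k + j + 1 - 1 - k = j by omega, show k + j + l - k = j + l by omega,
        show k + j - k = j by omega, show ((k + j : ℕ) : ℤ) - k = j by push_cast; ring]
      exact h
    · linear_combination ((q ^ 2) ^ m * gaussBinom (q ^ 2)⁻¹ n m * qfact (q ^ 2)⁻¹ m) * hs
  rw [← sum_range_neg_one_pow_mul_qfact (q ^ 2)⁻¹ n, ← sum_neg_distrib,
    ← Ico_add_one_right_eq_Icc, sum_Ico_eq_sum_range]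
  refine sum_congr (by simp) fun m hm => ?_
  have hm' : m < n := by simpa using hm
  rw [add_comm 1 m, inner _ hm', qfact_succ, pow_mul, inv_pow]
  have hne : 1 - (q ^ 2) ^ (m + 1) ≠ 0 := sub_ne_zero.2 (hx _ m.succ_pos).symm
  have hne' : (q ^ 2) ^ (m + 1) ≠ 0 := pow_ne_zero _ hq2
  generalize (q ^ 2) ^ (m + 1) = a at *
  field_simp
  ring
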